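/- Suppose α ∈ ℝ/ℤ is irrational with bounded partial quotients (i.e., inf_{q ∈ ℤ₊} q⟨qα⟩ > 0), and let J be a finite partition of ℝ/ℤ into intervals, each of length strictly less than 1/2. Let s be the coding sequence s_n = (index l such that αn² + βn + γ ∈ J_l). Then for every β, γ ∈ ℝ/ℤ, R(s) = T(s) = 1, i.e., the sequence s admits no pinned repetitions: limsup_n (1 + (1/n)·sup{m : s_k = s_{k+n} for 1 ≤ k ≤ m}) = 1. -/

import Mathlib

open scoped ENNReal

noncomputable def Rn {A : Type*} (ω : ℤ → A) (n : ℕ) : ℝ≥0∞ :=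
  1 + (n : ℝ≥0∞)⁻¹ *
    sSup ((fun m : ℕ => (m : ℝ≥0∞)) ''
      {m : ℕ | ∀ k : ℕ, 1 ≤ k → k ≤ m → ω (k : ℤ) = ω ((k : ℤ) + n)})

noncomputable def Tn {A : Type*} (ω : ℤ → A) (n : ℕ) : ℝ≥0∞ :=
  1 + (n : ℝ≥0∞)⁻¹ *
    sSup ((fun m : ℕ => (m : ℝ≥0∞)) ''
      {m : ℕ | ∀ k : ℕ, 1 ≤ k → k ≤ m →
        ω (k : ℤ) = ω ((k : ℤ) + n) ∧ ω ((n : ℤ) + 1 - k) = ω (1 - (k : ℤ))})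

noncomputable def RRep {A : Type*} (ω : ℤ → A) : ℝ≥0∞ := Filter.atTop.limsup (Rn ω)

noncomputable def TRep {A : Type*} (ω : ℤ → A) : ℝ≥0∞ := Filter.atTop.limsup (Tn ω)

/-- `⟨t⟩`, the distance from `t` to the nearest integer. -/
noncomputable def distInt (t : ℝ) : ℝ := |t - round t|

lemma walk (u : ℕ → ℝ) (I : ℕ) (w z : ℝ) (hstep : ∀ i < I, u (i+1) < u i + w)
    (htot : u 0 + 1 ≤ u I) : ∃ i ≤ I, ∃ m : ℤ, z < u i - m ∧ u i - m < z + w := by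
  classical
  obtain ⟨m, hm1, hm2⟩ : ∃ m : ℤ, z - 1 < u 0 - m ∧ u 0 - m ≤ z := by
    refine ⟨⌈u 0 - z⌉, ?_, ?_⟩
    · linarith [Int.ceil_lt_add_one (u 0 - z)]
    · linarith [Int.le_ceil (u 0 - z)]
  have hex : ∃ i, z < u i - m := ⟨I, by linarith⟩
  have hI : Nat.find hex ≤ I := Nat.find_min' hex (by linarith)
  have hsp := Nat.find_spec hex
  refine ⟨Nat.find hex, hI, m, hsp, ?_⟩
  rcases hi : Nat.find hex with _ | i
  · rw [hi] at hsp; linarith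
  · have h1 : ¬ z < u i - m := Nat.find_min hex (by omega)
    have h2 := hstep i (by omega)
    push Not at h1
    linarith

lemma linear_hit (θ : ℝ) (hθ : Irrational θ) (w : ℝ) (hw : 0 < w) :
    ∃ J : ℕ, ∀ b z : ℝ, ∃ j ≤ J, ∃ m : ℤ,
      z < θ * j + b - m ∧ θ * j + b - m < z + w := by
  obtain ⟨n, hn⟩ := exists_nat_one_div_lt hw
  obtain ⟨k, hk, -, hk2⟩ := Real.exists_nat_abs_mul_sub_round_le θ (Nat.succ_pos n)
  set p : ℤ := round ((k : ℝ) * θ) with hp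
  set φ : ℝ := k * θ - p with hφ
  have hφw : |φ| < w := by
    refine lt_of_le_of_lt hk2 (lt_of_le_of_lt ?_ hn)
    apply one_div_le_one_div_of_le
    · positivity
    · push_cast; linarith
  have hφ0 : φ ≠ 0 := by
    intro h
    have h1 : Irrational ((k : ℝ) * θ) := hθ.natCast_mul hk.ne'
    exact h1.ne_int p (by linarith)
  have hφp : 0 < |φ| := abs_pos.mpr hφ0
  obtain ⟨I, hI⟩ := exists_nat_ge (1 / |φ|)
  have hI' : 1 ≤ I * |φ| := by rwa [div_le_iff₀ hφp] at hI
  refine ⟨k * I, fun b z => ?_⟩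
  rcases lt_or_gt_of_ne hφ0 with hneg | hpos
  · rw [abs_of_neg hneg] at hI' hφw
    obtain ⟨i, hi, m, h1, h2⟩ := walk (fun i => -(i * φ + b)) I w (-z - w)
      (fun i _ => by push_cast; linarith) (by push_cast; linarith)
    refine ⟨k * i, Nat.mul_le_mul_left _ hi, -m + i * p, ?_, ?_⟩ <;>
    · push_cast
      simp only [hφ] at h1 h2
      linarith
  · rw [abs_of_pos hpos] at hI' hφw
    obtain ⟨i, hi, m, h1, h2⟩ := walk (fun i => (i * φ + b)) I w z
      (fun i _ => by push_cast; linarith) (by push_cast; linarith)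
    refine ⟨k * i, Nat.mul_le_mul_left _ hi, m + i * p, ?_, ?_⟩ <;>
    · push_cast
      simp only [hφ] at h1 h2
      linarith

lemma square_rec (A ε : ℝ) (hε : 0 < ε) :
    ∃ r : ℕ, 0 < r ∧ ∃ p : ℤ, |A * (r : ℝ)^2 - p| < ε := by
  obtain ⟨K0, hK0⟩ := exists_nat_gt (4 / ε)
  have hKp : (0 : ℝ) < K0 := lt_trans (by positivity) hK0
  have hlt : ∀ n : ℕ, ⌊(K0 : ℝ) * Int.fract (A * (n : ℝ)^2)⌋₊ < K0 := by
    intro n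
    rw [Nat.floor_lt (by positivity)]
    nlinarith [Int.fract_lt_one (A * (n : ℝ)^2)]
  obtain ⟨r, hr, b, c, h⟩ := Combinatorics.exists_mono_homothetic_copy
    (Finset.range 3) (fun n : ℕ => (⟨_, hlt n⟩ : Fin K0))
  have hb : ∀ x ∈ Finset.range 3,
      (c : ℝ) ≤ K0 * Int.fract (A * ((r * x + b : ℕ) : ℝ)^2) ∧
      K0 * Int.fract (A * ((r * x + b : ℕ) : ℝ)^2) < c + 1 := by
    intro x hx
    have h1 := congrArg Fin.val (h x hx)
    simp only [smul_eq_mul] at h1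
    rw [Nat.floor_eq_iff (by positivity)] at h1
    exact h1
  have h0 := hb 0 (by simp)
  have h1 := hb 1 (by simp)
  have h2 := hb 2 (by simp)
  push_cast at h0 h1 h2
  set y0 := A * ((r : ℝ) * 0 + b)^2
  set y1 := A * ((r : ℝ) * 1 + b)^2
  set y2 := A * ((r : ℝ) * 2 + b)^2
  refine ⟨2 * r, by omega, 2 * (⌊y0⌋ - 2 * ⌊y1⌋ + ⌊y2⌋), ?_⟩
  have e0 := Int.floor_add_fract y0
  have e1 := Int.floor_add_fract y1
  have e2 := Int.floor_add_fract y2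
  have key : A * ((2 * r : ℕ) : ℝ)^2 - ((2 * (⌊y0⌋ - 2 * ⌊y1⌋ + ⌊y2⌋) : ℤ) : ℝ)
      = 2 * (Int.fract y0 - 2 * Int.fract y1 + Int.fract y2) := by
    have : A * ((2 * r : ℕ) : ℝ)^2 = 2 * (y0 - 2 * y1 + y2) := by
      simp only [y0, y1, y2]; push_cast; ring
    rw [this]; push_cast; linarith
  rw [key]
  rw [div_lt_iff₀ hε] at hK0
  have : |2 * (Int.fract y0 - 2 * Int.fract y1 + Int.fract y2)| * K0 < 4 := by
    have e := abs_mul (2 * (Int.fract y0 - 2 * Int.fract y1 + Int.fract y2)) (K0 : ℝ)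
    rw [abs_of_pos hKp] at e
    rw [← e, abs_lt]
    constructor <;> linarith
  by_contra hcon
  push Not at hcon
  nlinarith

lemma quad_hit (A : ℝ) (hA : Irrational A) (w : ℝ) (hw : 0 < w) :
    ∃ L : ℕ, ∀ B z : ℝ, ∃ j ≤ L, ∃ m : ℤ,
      z < A * (j : ℝ)^2 + B * j - m ∧ A * (j : ℝ)^2 + B * j - m < z + w := by
  obtain ⟨I, hI⟩ := exists_nat_ge (8 / w)
  rw [div_le_iff₀ hw] at hI
  obtain ⟨r, hr, p, hp⟩ := square_rec A (w / 8 / (2 * I + 1)) (by positivity)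
  rw [lt_div_iff₀ (by positivity)] at hp
  have hirr : Irrational (A * ((2 * r : ℕ) : ℝ)) := hA.mul_natCast (by omega)
  obtain ⟨J, hJ⟩ := linear_hit _ hirr (w / 4) (by positivity)
  refine ⟨J + r * I, fun B z => ?_⟩
  obtain ⟨j0, hj0, m0, hm1, hm2⟩ := hJ (B * r) (w / 4)
  set ρ := A * (r : ℝ)^2 - p with hρ
  set b := A * ((2 * r : ℕ) : ℝ) * j0 + B * r - m0 with hb
  have hstep : ∀ i : ℕ, i < I → |ρ * (2 * i + 1)| < w / 8 := by
    intro i hi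
    rw [abs_mul, abs_of_pos (by positivity : (0:ℝ) < 2 * i + 1)]
    refine lt_of_le_of_lt ?_ hp
    have : (i : ℝ) ≤ I := by exact_mod_cast hi.le
    gcongr
  let u : ℕ → ℝ := fun i => A * (j0 : ℝ)^2 + B * j0 + b * i + ρ * (i : ℝ)^2
  have hu : ∀ i, u (i+1) = u i + b + ρ * (2 * i + 1) := by
    intro i; simp only [u]; push_cast; ring
  have htot : ∀ i : ℕ, i ≤ I → u 0 + i * (w / 8) ≤ u i := by
    intro i
    induction i with
    | zero => intro _; simp
    | succ i ih =>
      intro hi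
      have h1 := abs_lt.mp (hstep i (by omega))
      have h2 := ih (by omega)
      rw [hu]; push_cast; linarith
  obtain ⟨i, hi, m, h1, h2⟩ := walk u I w z
    (fun i hi => by
      have h1 := abs_lt.mp (hstep i hi)
      rw [hu]; linarith)
    (by have := htot I le_rfl; linarith)
  have key : A * ((j0 + r * i : ℕ) : ℝ)^2 + B * ((j0 + r * i : ℕ) : ℝ)
      - ((m + m0 * i + p * i^2 : ℤ) : ℝ) = u i - m := by
    simp only [u, hb, hρ]; push_cast; ring
  refine ⟨j0 + r * i, ?_, m + m0 * i + p * i^2, ?_, ?_⟩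
  · have := Nat.mul_le_mul_left r hi
    omega
  · rw [key]; exact h1
  · rw [key]; exact h2

set_option maxHeartbeats 1600000 in
lemma core (α : ℝ) (hα : Irrational α) (c : ℝ) (hc : 0 < c)
    (hbpq : ∀ q : ℕ, 0 < q → c / q < distInt ((q : ℝ) * α))
    (δ : ℝ) (hδ : δ < 1 / 2) (β γ : ℝ) (f : ℤ → ℝ)
    (hf : ∀ k : ℤ, f k = Int.fract (α * (k : ℝ)^2 + β * k + γ))
    (ε : ℝ) (hε : 0 < ε) :
    ∃ n0 : ℕ, ∀ n ≥ n0, ∀ m : ℕ,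
      (∀ k : ℕ, 1 ≤ k → k ≤ m → |f ((k : ℤ) + n) - f k| < δ) → (m : ℝ) < ε * n := by
  obtain ⟨Q0, hQ0⟩ := exists_nat_one_div_lt (show (0:ℝ) < 1 - 2 * δ by linarith)
  set Q := Q0 + 1 with hQ
  have hQp : (0 : ℝ) < Q := by positivity
  set η : ℝ := ε * c / (16 * (Q : ℝ)^2) with hη
  have hηp : 0 < η := by positivity
  have hL : ∀ q : ℕ, ∃ L : ℕ, 0 < q → ∀ B z : ℝ, ∃ j ≤ L, ∃ m : ℤ,
      z < α * (q:ℝ)^2 * (j : ℝ)^2 + B * j - m ∧ α * (q:ℝ)^2 * (j : ℝ)^2 + B * j - m < z + η := by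
    intro q
    by_cases hq : 0 < q
    · have : Irrational (α * (q:ℝ)^2) := by
        have := hα.mul_natCast (m := q^2) (by positivity)
        exact_mod_cast this
      obtain ⟨L, h⟩ := quad_hit _ this η hηp
      exact ⟨L, fun _ => h⟩
    · exact ⟨0, fun h => absurd h hq⟩
  choose Lf hLf using hL
  set Lm := (Finset.range (Q+1)).sup Lf with hLm
  obtain ⟨n1, hn1⟩ := exists_nat_ge ((8 * Q * (Lm + 2) : ℝ) / ε)
  refine ⟨n1 + 1, fun n hn m hm => ?_⟩
  by_contra hcon
  push Not at hcon
  have hn1' : (n1 : ℝ) ≤ n := by exact_mod_cast (by omega : n1 ≤ n)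
  have hnp : (0 : ℝ) < n := by exact_mod_cast (by omega : 0 < n)
  have hbig : (8 * Q * (Lm + 2) : ℝ) ≤ ε * n := by
    have := hn1.trans hn1'
    rw [div_le_iff₀ hε] at this; linarith
  have hQ1 : (1 : ℝ) ≤ Q := by exact_mod_cast (by omega : 1 ≤ Q)
  have hm1 : 1 ≤ m := by
    have : (0 : ℝ) < m := lt_of_lt_of_le (by positivity) hcon
    exact_mod_cast this
  -- window
  set W := (m - 1) / (4 * Q) with hW
  have hWm : 4 * Q * W ≤ m - 1 := Nat.mul_div_le _ _
  have hWl : (ε * n) / (8 * Q) ≤ W := by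
    have h1 : m - 1 < 4 * Q * (W + 1) := Nat.lt_mul_div_succ _ (by omega)
    have h2 : m ≤ 4 * Q * (W + 1) := by omega
    have h3 : (m : ℝ) ≤ 4 * Q * (W + 1) := by exact_mod_cast h2
    rw [div_le_iff₀ (by positivity)]
    have h4 : (0:ℝ) ≤ Q * Lm := by positivity
    nlinarith
  have hWL : Lm ≤ W := by
    have : (Lm : ℝ) ≤ W := by
      refine le_trans ?_ hWl
      rw [le_div_iff₀ (by positivity)]
      linarith
    exact_mod_cast this
  obtain ⟨q, hq, hqQ, hq2⟩ := Real.exists_nat_abs_mul_sub_round_le (2 * n * α)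
    (show 0 < Q by omega)
  have hLq : Lf q ≤ W := le_trans (Finset.le_sup (f := Lf) (by simp; omega)) hWL
  have hqp : (0 : ℝ) < q := by exact_mod_cast hq
  have hqQ' : (q : ℝ) ≤ Q := by exact_mod_cast hqQ
  have hbd := hbpq (2 * n * q) (by have : 0 < n := by omega
                                   positivity)
  have hmul : ((2 * n * q : ℕ) : ℝ) * α = q * (2 * n * α) := by push_cast; ring
  rw [hmul] at hbd
  unfold distInt at hbd
  set p : ℤ := round ((q : ℝ) * (2 * n * α)) with hp
  set φ : ℝ := q * (2 * n * α) - p with hφ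
  have hφs : |φ| < 1 - 2 * δ := by
    refine lt_of_le_of_lt hq2 (lt_of_le_of_lt ?_ hQ0)
    apply one_div_le_one_div_of_le (by positivity)
    rw [hQ]; push_cast; linarith
  have hφη : η ≤ W * |φ| := by
    have h1 : c / (2 * n * Q) ≤ |φ| := by
      refine le_trans ?_ hbd.le
      push_cast
      gcongr
    calc η = (ε * n) / (8 * Q) * (c / (2 * n * Q)) := by
          rw [hη]; field_simp; norm_num
      _ ≤ W * |φ| := by gcongr
  -- the points
  let k : ℕ → ℕ := fun j => 1 + q * j
  have hk : ∀ j ≤ 4 * W, 1 ≤ k j ∧ k j ≤ m := by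
    intro j hj
    refine ⟨by simp [k], ?_⟩
    have h1 : q * j ≤ Q * (4 * W) := Nat.mul_le_mul hqQ hj
    have h2 : Q * (4 * W) = 4 * Q * W := by ring
    simp only [k]; omega
  let g : ℕ → ℝ := fun j => f ((k j : ℤ) + n) - f (k j)
  have hg : ∀ j ≤ 4 * W, |g j| < δ := fun j hj => hm (k j) (hk j hj).1 (hk j hj).2
  have hglin : ∀ j ≤ 4 * W, g j = g 0 + j * φ := by
    intro j
    induction j with
    | zero => intro _; simp
    | succ j ih =>
      intro hj
      have e := ih (by omega)
      have b1 := abs_lt.mp (hg j (by omega))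
      have b2 := abs_lt.mp (hg (j+1) hj)
      have b3 := abs_lt.mp hφs
      obtain ⟨z, hz⟩ : ∃ z : ℤ, g (j+1) - g j - φ = z := by
        simp only [g, hf, Int.fract]
        refine ⟨p - ⌊α * (((k (j+1) : ℤ) + n : ℤ) : ℝ)^2 + β * (((k (j+1) : ℤ) + n : ℤ) : ℝ) + γ⌋
          + ⌊α * ((k (j+1) : ℤ) : ℝ)^2 + β * ((k (j+1) : ℤ) : ℝ) + γ⌋
          + ⌊α * (((k j : ℤ) + n : ℤ) : ℝ)^2 + β * (((k j : ℤ) + n : ℤ) : ℝ) + γ⌋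
          - ⌊α * ((k j : ℤ) : ℝ)^2 + β * ((k j : ℤ) : ℝ) + γ⌋, ?_⟩
        rw [hφ]
        simp only [Int.cast_add, Int.cast_sub]
        simp only [k]
        push_cast
        ring
      have hz0 : z = 0 := by
        have l1 : (z : ℝ) < 1 := by rw [← hz]; linarith
        have l2 : (-1 : ℝ) < z := by rw [← hz]; linarith
        have l1' : z < 1 := by exact_mod_cast l1
        have l2' : -1 < z := by exact_mod_cast l2
        omega
      rw [hz0] at hz
      push_cast at hz ⊢
      linarith
  -- hitting
  have hit : ∀ (j1 : ℕ) (v : ℝ), 0 ≤ v → v + η ≤ 1 → ∃ j ≤ W,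
      v < f (k (j1 + j)) ∧ f (k (j1 + j)) < v + η := by
    intro j1 v hv0 hv1
    set x1 : ℝ := ((k j1 : ℕ) : ℝ) with hx1
    obtain ⟨j, hj, m', h1, h2⟩ := hLf q hq (2 * α * x1 * q + β * q)
      (v - (α * x1^2 + β * x1 + γ))
    refine ⟨j, hj.trans hLq, ?_⟩
    have hk' : ((k (j1 + j) : ℤ) : ℝ) = x1 + q * j := by
      simp only [hx1, k]; push_cast; ring
    have hv : f (k (j1 + j)) = (α * x1^2 + β * x1 + γ) +
        (α * (q:ℝ)^2 * (j : ℝ)^2 + (2 * α * x1 * q + β * q) * j - m') := by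
      rw [hf, hk', Int.fract_eq_iff]
      refine ⟨by linarith, by linarith, m', ?_⟩
      ring
    rw [hv]
    constructor <;> linarith
  have finish : ∀ j1 : ℕ, j1 + W ≤ 4 * W →
      ((∀ j ≤ W, η ≤ g (j1 + j)) ∨ (∀ j ≤ W, g (j1 + j) ≤ -η)) → False := by
    intro j1 hj1 h
    have hg0 := abs_lt.mp (hg j1 (by omega))
    rcases h with h | h
    · have h0 := h 0 (Nat.zero_le _)
      rw [add_zero] at h0
      obtain ⟨j, hj, h1, h2⟩ := hit j1 (1 - η) (by linarith) (by linarith)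
      have h3 := h j hj
      have h4 : f ((k (j1 + j) : ℤ) + n) < 1 := by rw [hf]; exact Int.fract_lt_one _
      simp only [g] at h3
      linarith
    · have h0 := h 0 (Nat.zero_le _)
      rw [add_zero] at h0
      obtain ⟨j, hj, h1, h2⟩ := hit j1 0 le_rfl (by linarith)
      have h3 := h j hj
      have h4 : 0 ≤ f ((k (j1 + j) : ℤ) + n) := by rw [hf]; exact Int.fract_nonneg _
      simp only [g] at h3
      linarith
  have hmid := hglin (2 * W) (by omega)
  push_cast at hmid
  rcases le_total 0 φ with hs | hs <;> rcases le_total 0 (g (2 * W)) with hm0 | hm0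
  · rw [abs_of_nonneg hs] at hφη
    refine finish (3 * W) (by omega) (Or.inl fun j hj => ?_)
    rw [hglin _ (by omega)]; push_cast
    nlinarith [mul_nonneg (Nat.cast_nonneg (α := ℝ) j) hs]
  · rw [abs_of_nonneg hs] at hφη
    refine finish 0 (by omega) (Or.inr fun j hj => ?_)
    rw [hglin _ (by omega)]; push_cast
    have : (j : ℝ) ≤ W := by exact_mod_cast hj
    nlinarith [mul_le_mul_of_nonneg_right this hs]
  · rw [abs_of_nonpos hs] at hφη
    refine finish 0 (by omega) (Or.inl fun j hj => ?_)
    rw [hglin _ (by omega)]; push_cast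
    have : (j : ℝ) ≤ W := by exact_mod_cast hj
    nlinarith [mul_le_mul_of_nonpos_right this hs]
  · rw [abs_of_nonpos hs] at hφη
    refine finish (3 * W) (by omega) (Or.inr fun j hj => ?_)
    rw [hglin _ (by omega)]; push_cast
    nlinarith [mul_nonneg (Nat.cast_nonneg (α := ℝ) j) (neg_nonneg.mpr hs)]

lemma one_le_limsup (u : ℕ → ℝ≥0∞) (h : ∀ n, 1 ≤ u n) : 1 ≤ Filter.atTop.limsup u := by
  have := Filter.limsup_le_limsup (f := Filter.atTop) (u := fun _ : ℕ => (1 : ℝ≥0∞)) (v := u)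
    (Filter.Eventually.of_forall h)
  simpa using this

lemma Tn_le_Rn (s : ℤ → ℕ) (n : ℕ) : Tn s n ≤ Rn s n := by
  unfold Tn Rn
  gcongr with m
  intro hm
  exact hm.1

/-- If `α` has bounded partial quotients and each arc of the finite interval
partition of `ℝ/ℤ` has length `< 1/2`, then the coding of `n ↦ αn² + βn + γ`
has no pinned repetitions: `R(s) = T(s) = 1`.  The partition is given by an
offset `a` and cut points `t 0 = 0 < t 1 < ⋯ < t N = 1`; the arcs are
`{x : t l ≤ fract (x - a) < t (l+1)}` for `0 ≤ l < N`. -/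
theorem no_repetitions_bounded_partial_quotients
    (α : ℝ) (hα : Irrational α)
    (hbpq : ∃ c : ℝ, 0 < c ∧ ∀ q : ℕ, 0 < q → c / q < distInt ((q : ℝ) * α))
    (N : ℕ) (hN : 0 < N) (a : ℝ) (t : ℕ → ℝ)
    (ht0 : t 0 = 0) (htN : t N = 1)
    (hmono : ∀ l < N, t l < t (l + 1))
    (hlen : ∀ l < N, t (l + 1) - t l < 1 / 2)
    (β γ : ℝ) (s : ℤ → ℕ)
    (hs : ∀ n : ℤ, ∀ l < N,
      (s n = l ↔ Int.fract ((α * (n : ℝ) ^ 2 + β * n + γ) - a) ∈ Set.Ico (t l) (t (l + 1)))) :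
    RRep s = 1 ∧ TRep s = 1 := by
  obtain ⟨c, hc, hbpq⟩ := hbpq
  obtain ⟨δ, hδ, hlenδ⟩ : ∃ δ : ℝ, δ < 1 / 2 ∧ ∀ l < N, t (l + 1) - t l ≤ δ := by
    obtain ⟨l0, hl0, h⟩ := Finset.exists_max_image (Finset.range N)
      (fun l => t (l + 1) - t l) ⟨0, by simpa using hN⟩
    exact ⟨_, hlen l0 (by simpa using hl0), fun l hl => h l (by simpa using hl)⟩
  let f : ℤ → ℝ := fun k => Int.fract (α * (k : ℝ) ^ 2 + β * k + (γ - a))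
  have hfe : ∀ k : ℤ, Int.fract ((α * (k : ℝ) ^ 2 + β * k + γ) - a) = f k := by
    intro k; simp only [f]; congr 1; ring
  have hcover : ∀ x : ℝ, 0 ≤ x → ∀ M : ℕ, x < t M → ∃ l < M, x ∈ Set.Ico (t l) (t (l + 1)) := by
    intro x hx M
    induction M with
    | zero => intro h; linarith
    | succ M ih =>
      intro h
      by_cases h' : x < t M
      · obtain ⟨l, hl, h2⟩ := ih h'
        exact ⟨l, by omega, h2⟩
      · exact ⟨M, by omega, not_lt.mp h', h⟩
  have hclose : ∀ k k' : ℤ, s k = s k' → |f k' - f k| < δ := by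
    intro k k' h
    obtain ⟨l, hl, hx⟩ := hcover (f k) (Int.fract_nonneg _) N
      (by rw [htN]; exact Int.fract_lt_one _)
    have h1 : s k = l := (hs k l hl).2 (by rw [hfe]; exact hx)
    have h2 := (hs k' l hl).1 (by rw [← h, h1])
    rw [hfe] at h2
    have h3 := hlenδ l hl
    rw [abs_lt]
    constructor <;> linarith [hx.1, hx.2, h2.1, h2.2]
  have hR : RRep s ≤ 1 := by
    apply ENNReal.le_of_forall_pos_le_add
    intro ε hε _
    obtain ⟨n0, hn0⟩ := core α hα c hc hbpq δ hδ β (γ - a) f (fun _ => rfl) ε hε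
    unfold RRep
    apply Filter.limsup_le_of_le
    · isBoundedDefault
    filter_upwards [Filter.eventually_ge_atTop (n0 + 1)] with n hn
    unfold Rn
    gcongr
    have hn' : (n : ℝ≥0∞) ≠ 0 := by
      have : n ≠ 0 := by omega
      exact_mod_cast this
    rw [mul_comm, ← div_eq_mul_inv]
    apply ENNReal.div_le_of_le_mul
    apply sSup_le
    rintro _ ⟨m, hm, rfl⟩
    have h1 := hn0 n (by omega) m (fun k hk1 hk2 => hclose _ _ (hm k hk1 hk2))
    have h2 : (m : NNReal) ≤ ε * n := by
      rw [← NNReal.coe_le_coe]; push_cast; exact h1.le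
    have h3 : ((m : NNReal) : ℝ≥0∞) ≤ ((ε * n : NNReal) : ℝ≥0∞) := ENNReal.coe_le_coe.mpr h2
    simpa using h3
  have hT : TRep s ≤ RRep s :=
    Filter.limsup_le_limsup (Filter.Eventually.of_forall (Tn_le_Rn s))
  exact ⟨le_antisymm hR (one_le_limsup _ fun n => le_self_add),
    le_antisymm (hT.trans hR) (one_le_limsup _ fun n => le_self_add)⟩
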